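/- arXiv:1001.4853 — 2 statements merged into one kernel-verified Lean document; each statement's English description precedes it below -/
import Mathlib

section
/- Let μ = exp(2πi/7). Every nonzero homogeneous cubic polynomial F ∈ ℂ[x₁,…,x₅] for which there exists λ ∈ ℂ with F(μz₁, μ²z₂, μ⁴z₃, z₄, z₅) = λ·F(z₁,…,z₅) for all z ∈ ℂ⁵ defines a singular cubic threefold: there exists a nonzero point z ∈ ℂ⁵ at which all five partial derivatives of F vanish. -/
open MvPolynomial

/-- μ = exp(2πi/7), a primitive 7th root of unity. -/
noncomputable def μ : ℂ := Complex.exp (2 * Real.pi * Complex.I / 7)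

/-- The eigenvalues (μ, μ², μ⁴, 1, 1) of the order-7 case with eigenvalues (μ, μ², μ⁴, 1, 1). -/
noncomputable def mu7Diag2 : Fin 5 → ℂ := ![μ, μ ^ 2, μ ^ 4, 1, 1]

/-- Rescaling the variables of a polynomial by `d` multiplies the coefficient at `m` by `d ^ m`. -/
lemma coeff_bind₁_C_mul_X {σ R : Type*} [CommSemiring R] (d : σ → R) (F : MvPolynomial σ R)
    (m : σ →₀ ℕ) :
    coeff m (bind₁ (fun i => C (d i) * X i) F) = (m.prod fun i k => d i ^ k) * coeff m F := by
  classical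
  induction F using MvPolynomial.induction_on' with
  | monomial u a =>
    have h : bind₁ (fun i => C (d i) * X i) (monomial u a) =
        monomial u ((u.prod fun i k => d i ^ k) * a) := by
      rw [bind₁_monomial, mul_comm (u.prod _) a, ← C_mul_monomial, ← mul_one (u.prod _),
        ← C_mul_monomial, monomial_eq (s := u) (a := 1)]
      simp [mul_pow, Finset.prod_mul_distrib, Finsupp.prod]
    rw [h, coeff_monomial, coeff_monomial]
    split_ifs with hu
    · rw [hu]
    · simp
  | add p q hp hq => simp only [map_add, coeff_add, hp, hq, mul_add]

/-- A form of degree `n` takes the coefficient of `X i ^ n` as its value at the `i`-th coordinate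
point. -/
lemma MvPolynomial.IsHomogeneous.eval_single {σ R : Type*} [DecidableEq σ] [Fintype σ]
    [CommSemiring R] {F : MvPolynomial σ R} {n : ℕ} (hF : F.IsHomogeneous n) (i : σ) :
    eval (Pi.single i 1) F = coeff (Finsupp.single i n) F := by
  rw [eval_eq', Finset.sum_eq_single (Finsupp.single i n)]
  · rw [Finset.prod_eq_one, mul_one]
    intro j _
    by_cases h : j = i
    · subst h; simp
    · simp [Finsupp.single_eq_of_ne h]
  · intro m hm hne
    obtain ⟨j, hji, hj⟩ : ∃ j, j ≠ i ∧ m j ≠ 0 := by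
      by_contra! h
      have hm' : m = Finsupp.single i (m i) := by
        ext j
        by_cases hj : j = i
        · subst hj; simp
        · rw [h j hj, Finsupp.single_eq_of_ne hj]
      have hdeg : n = m.degree := hF.degree_eq_sum_deg_support hm
      rw [hm', Finsupp.degree_single] at hdeg
      exact hne (hdeg ▸ hm')
    rw [Finset.prod_eq_zero (Finset.mem_univ j), mul_zero]
    rw [Pi.single_eq_of_ne hji, zero_pow hj]
  · intro h
    rw [notMem_support_iff.mp h, zero_mul]

lemma isPrimitiveRoot_μ : IsPrimitiveRoot μ 7 := by
  simpa [μ] using Complex.isPrimitiveRoot_exp 7 (by norm_num)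

lemma mu7Diag2_eq_pow (i : Fin 5) : mu7Diag2 i = μ ^ (![1, 2, 4, 0, 0] : Fin 5 → ℕ) i := by
  fin_cases i <;> simp [mu7Diag2]

/-- every nonzero homogeneous cubic F ∈ ℂ[x₁,…,x₅] which is an eigenvector for
(z₁,…,z₅) ↦ (μz₁, μ²z₂, μ⁴z₃, z₄, z₅) defines a singular cubic threefold: all five partial
derivatives of F vanish at some nonzero point of ℂ⁵. -/
theorem order7_case2_eigencubics_singular (F : MvPolynomial (Fin 5) ℂ) (hF : F ≠ 0)
    (hhom : F.IsHomogeneous 3)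
    (heig : ∃ lam : ℂ, ∀ z : Fin 5 → ℂ, eval (fun i => mu7Diag2 i * z i) F = lam * eval z F) :
    ∃ z : Fin 5 → ℂ, z ≠ 0 ∧ ∀ i : Fin 5, eval z (pderiv i F) = 0 := by
  obtain ⟨lam, hlam⟩ := heig
  have hG : bind₁ (fun i => C (mu7Diag2 i) * X i) F = C lam * F := by
    refine MvPolynomial.funext fun z => ?_
    rw [← coe_aeval_eq_eval, RingHom.coe_coe, aeval_bind₁]
    simpa [aeval_eq_eval] using hlam z
  let w : Fin 5 → ℕ := ![1, 2, 4, 0, 0]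
  let wt : (Fin 5 →₀ ℕ) → ℕ := fun m => m.sum fun i k => w i * k
  have hwt (m : Fin 5 →₀ ℕ) (hm : coeff m F ≠ 0) : μ ^ wt m = lam := by
    have h := congrArg (coeff m) hG
    rw [coeff_bind₁_C_mul_X, coeff_C_mul] at h
    rw [← mul_right_cancel₀ hm h]
    simp only [mu7Diag2_eq_pow, ← pow_mul, wt, w, Finsupp.prod, Finsupp.sum,
      Finset.prod_pow_eq_pow_sum]
  obtain ⟨m₀, hm₀⟩ := ne_zero_iff.mp hF
  obtain ⟨i, hi⟩ : ∃ i : Fin 5, ∀ j, (w i * 2 + w j) % 7 ≠ wt m₀ % 7 := by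
    have h : ∀ r < 7, ∃ i : Fin 5, ∀ j, (w i * 2 + w j) % 7 ≠ r := by decide
    exact h _ (Nat.mod_lt _ (by norm_num))
  refine ⟨Pi.single i 1, by simp, fun j => ?_⟩
  rw [hhom.pderiv.eval_single, coeff_pderiv]
  have h0 : coeff (Finsupp.single i 2 + Finsupp.single j 1) F = 0 := by
    by_contra h
    have he := (hwt _ h).trans (hwt _ hm₀).symm
    have hsum : wt (Finsupp.single i 2 + Finsupp.single j 1) = w i * 2 + w j := by
      simp only [wt]
      rw [Finsupp.sum_add_index' (by simp) (by intros; ring)]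
      simp
    rw [hsum] at he
    apply hi j
    rwa [(isPrimitiveRoot_μ.isOfFinOrder (by norm_num)).pow_inj_mod,
      ← isPrimitiveRoot_μ.eq_orderOf] at he
  simp [h0]
end

section
/- Let ξ = exp(2πi/11), let M_τ be the diagonal 5×5 complex matrix diag(ξ, ξ⁹, ξ³, ξ⁴, ξ⁵), and let M_σ be the 5×5 permutation matrix of the linear map (z₁,z₂,z₃,z₄,z₅) ↦ (z₅,z₁,z₄,z₂,z₃). If H is a 5×5 complex Hermitian matrix (conjugate-transpose of H equals H) satisfying M_τᵀ · H · conj(M_τ) = H and M_σᵀ · H · conj(M_σ) = H, then H = c·I₅ for some real number c, where I₅ is the 5×5 identity matrix. -/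
/-- ξ = exp(2πi/11), a primitive 11th root of unity. -/
noncomputable def ξ : ℂ := Complex.exp (2 * Real.pi * Complex.I / 11)

/-- M_τ = diag(ξ, ξ⁹, ξ³, ξ⁴, ξ⁵), the analytic representation of the order-11 automorphism. -/
noncomputable def Mτ : Matrix (Fin 5) (Fin 5) ℂ := Matrix.diagonal ![ξ, ξ ^ 9, ξ ^ 3, ξ ^ 4, ξ ^ 5]

/-- M_σ, the permutation matrix of (z₁,z₂,z₃,z₄,z₅) ↦ (z₅,z₁,z₄,z₂,z₃). -/
def Mσ : Matrix (Fin 5) (Fin 5) ℂ :=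
  !![0, 0, 0, 0, 1;
     1, 0, 0, 0, 0;
     0, 0, 0, 1, 0;
     0, 1, 0, 0, 0;
     0, 0, 1, 0, 0]

theorem isPrimitiveRoot_ξ : IsPrimitiveRoot ξ 11 := by
  simpa [ξ] using Complex.isPrimitiveRoot_exp 11 (by norm_num)

/-- A matrix invariant under a diagonal matrix of distinct unit complex numbers is diagonal. -/
theorem apply_eq_zero_of_diagonal_invariant {n : Type*} [Fintype n] [DecidableEq n]
    {d : n → ℂ} (hd : ∀ i, ‖d i‖ = 1) (hinj : Function.Injective d) {H : Matrix n n ℂ}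
    (hH : (Matrix.diagonal d).transpose * H * (Matrix.diagonal d).map (starRingEnd ℂ) = H)
    {i j : n} (hij : i ≠ j) : H i j = 0 := by
  rw [Matrix.diagonal_transpose, Matrix.diagonal_map (map_zero _)] at hH
  have h := congrFun (congrFun hH i) j
  rw [Matrix.mul_diagonal, Matrix.diagonal_mul] at h
  have hj : starRingEnd ℂ (d j) * d j = 1 := by
    rw [Complex.conj_mul', hd]; norm_num
  have hmul : (d i - d j) * H i j = 0 := by
    linear_combination d j * h - d i * H i j * hj
  exact (mul_eq_zero.mp hmul).resolve_left (sub_ne_zero.mpr (hinj.ne hij))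

theorem Mτ_eq_diagonal_pow :
    Mτ = Matrix.diagonal fun i : Fin 5 => ξ ^ (![1, 9, 3, 4, 5] : Fin 5 → ℕ) i := by
  unfold Mτ
  congr 1
  funext i
  fin_cases i <;> simp

/-- a Hermitian 5×5 matrix H with M_τᵀ·H·conj(M_τ) = H and M_σᵀ·H·conj(M_σ) = H
is a real scalar multiple of the identity. -/
theorem invariant_hermitian_is_scalar (H : Matrix (Fin 5) (Fin 5) ℂ)
    (hherm : H.conjTranspose = H)
    (hτ : Mτ.transpose * H * Mτ.map (starRingEnd ℂ) = H)
    (hσ : Mσ.transpose * H * Mσ.map (starRingEnd ℂ) = H) :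
    ∃ c : ℝ, H = (c : ℂ) • (1 : Matrix (Fin 5) (Fin 5) ℂ) := by
  have hoff : ∀ i j, i ≠ j → H i j = 0 := by
    intro i j hij
    rw [Mτ_eq_diagonal_pow] at hτ
    refine apply_eq_zero_of_diagonal_invariant (fun k => ?_) (fun k l hkl => ?_) hτ hij
    · rw [norm_pow, isPrimitiveRoot_ξ.norm'_eq_one (by norm_num), one_pow]
    · have hlt : ∀ m, (![1, 9, 3, 4, 5] : Fin 5 → ℕ) m < 11 := by decide
      have hexp : Function.Injective (![1, 9, 3, 4, 5] : Fin 5 → ℕ) := by decide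
      exact hexp (isPrimitiveRoot_ξ.pow_inj (hlt k) (hlt l) hkl)
  have hdiag : ∀ i, H i i = H 0 0 := by
    have h := fun i => congrFun (congrFun hσ i) i
    have h0 := h 0
    have h1 := h 1
    have h2 := h 2
    have h3 := h 3
    simp [Mσ, Matrix.mul_apply, Fin.sum_univ_five] at h0 h1 h2 h3
    intro i
    fin_cases i <;> simp [*]
  have hreal : ((H 0 0).re : ℂ) = H 0 0 :=
    Complex.conj_eq_iff_re.mp (congrFun (congrFun hherm 0) 0)
  refine ⟨(H 0 0).re, ?_⟩
  ext i j
  rw [hreal, Matrix.smul_apply, smul_eq_mul]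
  by_cases hij : i = j
  · subst hij
    rw [hdiag, Matrix.one_apply_eq, mul_one]
  · rw [hoff i j hij, Matrix.one_apply_ne hij, mul_zero]
end
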